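/- Let ℓ ≥ 1 be an integer, I ∈ ℝ^{n+2} a fixed vector, and Φ a smooth function on ℝ^{n+2} ∖ {0} homogeneous of degree ℓ − n/2. Then (I·D)^ℓ Φ = (−1)^ℓ (I·X)^ℓ □^ℓ Φ, where I·D := I^A D_A, I·X := η_{AB} I^A X^B, and (I·D)^ℓ denotes the ℓ-fold composition of the operator I·D. -/

import Mathlib

noncomputable section

/-- Partial derivative in coordinate direction `A` of a function on `ℝ^m`. -/
def pd {m : ℕ} (A : Fin m) (f : (Fin m → ℝ) → ℝ) : (Fin m → ℝ) → ℝ :=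
  fun x => fderiv ℝ f x (Pi.single A 1)

/-- The Euler operator `X·∂`. -/
def euler {m : ℕ} (f : (Fin m → ℝ) → ℝ) : (Fin m → ℝ) → ℝ :=
  fun x => ∑ A, x A * pd A f x

/-- The Laplacian `□ = η^{AB} ∂_A ∂_B` for the diagonal metric with entries `ε`. -/
def lap {m : ℕ} (ε : Fin m → ℝ) (f : (Fin m → ℝ) → ℝ) : (Fin m → ℝ) → ℝ :=
  fun x => ∑ A, ε A * pd A (pd A f) x

/-- `X² = η_{AB} X^A X^B` for the diagonal metric with entries `ε`. -/
def xsq {m : ℕ} (ε : Fin m → ℝ) (x : Fin m → ℝ) : ℝ :=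
  ∑ A, ε A * x A ^ 2

/-- `ε` is a diagonal metric with all entries `±1` and exactly `q` entries equal to `-1`,
i.e. a nondegenerate symmetric bilinear form of signature `(m - q, q)`. -/
def isSig {m : ℕ} (ε : Fin m → ℝ) (q : ℕ) : Prop :=
  (∀ A, ε A = 1 ∨ ε A = -1) ∧ Nat.card {A : Fin m // ε A = -1} = q

/-- The flat Thomas-D operator `D_A = 2(X·∂ + c)∂_A - X_A □` (with `c = n/2`). -/
def thomasD {m : ℕ} (ε : Fin m → ℝ) (c : ℝ) (A : Fin m) (f : (Fin m → ℝ) → ℝ) :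
    (Fin m → ℝ) → ℝ :=
  fun x => 2 * (euler (pd A f) x + c * pd A f x) - ε A * x A * lap ε f x

/-- The operator `I·D = I^A D_A` for a fixed ambient vector `I`. -/
def opID {m : ℕ} (ε : Fin m → ℝ) (c : ℝ) (I : Fin m → ℝ) (f : (Fin m → ℝ) → ℝ) :
    (Fin m → ℝ) → ℝ :=
  fun x => ∑ A, I A * thomasD ε c A f x

section Calculus

variable {m : ℕ} {U : Set (Fin m → ℝ)} {f g : (Fin m → ℝ) → ℝ}

/-- The linear function `I·X` for the diagonal metric with entries `ε`. -/
def linForm (ε I x : Fin m → ℝ) : ℝ := ∑ A, ε A * I A * x A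

/-- The directional derivative `I·∂`. -/
def dirDeriv (I : Fin m → ℝ) (f : (Fin m → ℝ) → ℝ) : (Fin m → ℝ) → ℝ :=
  fun x => ∑ A, I A * pd A f x

lemma ContDiffOn.differentiableAt_of_isOpen (hU : IsOpen U) (hf : ContDiffOn ℝ (⊤ : ℕ∞) f U)
    {x : Fin m → ℝ} (hx : x ∈ U) : DifferentiableAt ℝ f x :=
  (hf.contDiffAt (hU.mem_nhds hx)).differentiableAt (by simp)

lemma ContDiffOn.pd (hU : IsOpen U) (hf : ContDiffOn ℝ (⊤ : ℕ∞) f U) (A : Fin m) :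
    ContDiffOn ℝ (⊤ : ℕ∞) (pd A f) U :=
  (hf.fderiv_of_isOpen hU (by simp)).clm_apply contDiffOn_const

lemma ContDiffOn.dirDeriv (hU : IsOpen U) (hf : ContDiffOn ℝ (⊤ : ℕ∞) f U) (I : Fin m → ℝ) :
    ContDiffOn ℝ (⊤ : ℕ∞) (dirDeriv I f) U :=
  ContDiffOn.sum fun A _ => contDiffOn_const.mul (hf.pd hU A)

lemma ContDiffOn.lap (hU : IsOpen U) (hf : ContDiffOn ℝ (⊤ : ℕ∞) f U) (ε : Fin m → ℝ) :
    ContDiffOn ℝ (⊤ : ℕ∞) (lap ε f) U :=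
  ContDiffOn.sum fun A _ => contDiffOn_const.mul ((hf.pd hU A).pd hU A)

lemma contDiff_linForm (ε I : Fin m → ℝ) : ContDiff ℝ (⊤ : ℕ∞) (linForm ε I) := by
  unfold linForm
  fun_prop

lemma pd_eqOn (hU : IsOpen U) (h : Set.EqOn f g U) (A : Fin m) : Set.EqOn (pd A f) (pd A g) U := by
  intro x hx
  simp only [pd, (h.eventuallyEq_of_mem (hU.mem_nhds hx)).fderiv_eq]

lemma lap_eqOn (hU : IsOpen U) (ε : Fin m → ℝ) (h : Set.EqOn f g U) :
    Set.EqOn (lap ε f) (lap ε g) U := by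
  intro x hx
  simp only [lap, pd_eqOn hU (pd_eqOn hU h _) _ hx]

lemma euler_eqOn (hU : IsOpen U) (h : Set.EqOn f g U) : Set.EqOn (euler f) (euler g) U := by
  intro x hx
  simp only [euler, pd_eqOn hU h _ hx]

lemma lap_iterate_eqOn (hU : IsOpen U) (ε : Fin m → ℝ) (h : Set.EqOn f g U) (k : ℕ) :
    Set.EqOn ((lap ε)^[k] f) ((lap ε)^[k] g) U := by
  induction k generalizing f g with
  | zero => exact h
  | succ k ih => exact ih (lap_eqOn hU ε h)

lemma pd_add {x : Fin m → ℝ} (hf : DifferentiableAt ℝ f x) (hg : DifferentiableAt ℝ g x)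
    (A : Fin m) : pd A (fun y => f y + g y) x = pd A f x + pd A g x := by
  simp [pd, fderiv_fun_add hf hg]

lemma pd_sub {x : Fin m → ℝ} (hf : DifferentiableAt ℝ f x) (hg : DifferentiableAt ℝ g x)
    (A : Fin m) : pd A (fun y => f y - g y) x = pd A f x - pd A g x := by
  simp [pd, fderiv_fun_sub hf hg]

lemma pd_const_mul {x : Fin m → ℝ} (hf : DifferentiableAt ℝ f x) (a : ℝ) (A : Fin m) :
    pd A (fun y => a * f y) x = a * pd A f x := by
  simp [pd, fderiv_const_mul hf]

lemma pd_mul {x : Fin m → ℝ} (hf : DifferentiableAt ℝ f x) (hg : DifferentiableAt ℝ g x)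
    (A : Fin m) : pd A (fun y => f y * g y) x = pd A f x * g x + f x * pd A g x := by
  simp [pd, fderiv_fun_mul hf hg]
  ring

lemma pd_sum {ι : Type*} (s : Finset ι) {F : ι → (Fin m → ℝ) → ℝ} {x : Fin m → ℝ}
    (hF : ∀ i ∈ s, DifferentiableAt ℝ (F i) x) (A : Fin m) :
    pd A (fun y => ∑ i ∈ s, F i y) x = ∑ i ∈ s, pd A (F i) x := by
  simp [pd, fderiv_fun_sum hF]

lemma pd_coord (A B : Fin m) (x : Fin m → ℝ) :
    pd A (fun y => y B) x = if B = A then 1 else 0 := by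
  simp [pd, fderiv_apply, Pi.single_apply]

lemma pd_linForm (ε I : Fin m → ℝ) (A : Fin m) (x : Fin m → ℝ) :
    pd A (linForm ε I) x = ε A * I A := by
  unfold linForm
  rw [pd_sum _ (fun i _ => by fun_prop)]
  simp_rw [pd_const_mul (differentiableAt_apply _ x), pd_coord]
  simp

lemma pd_comm (hU : IsOpen U) (hf : ContDiffOn ℝ (⊤ : ℕ∞) f U) (A B : Fin m) :
    Set.EqOn (pd A (pd B f)) (pd B (pd A f)) U := by
  intro x hx
  have hfx := hf.contDiffAt (hU.mem_nhds hx)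
  have hd : DifferentiableAt ℝ (fderiv ℝ f) x :=
    (hfx.fderiv_right (m := (⊤ : ℕ∞)) (by simp)).differentiableAt (by simp)
  have key : ∀ A B : Fin m,
      pd A (pd B f) x = fderiv ℝ (fderiv ℝ f) x (Pi.single A 1) (Pi.single B 1) := by
    intro A B
    change fderiv ℝ (fun y => fderiv ℝ f y (Pi.single B 1)) x (Pi.single A 1) = _
    rw [fderiv_clm_apply hd (differentiableAt_const _)]
    simp
  rw [key, key]
  exact (hfx.isSymmSndFDerivAt (by simpa using WithTop.coe_le_coe.2 (le_top (a := (2 : ℕ∞))))) _ _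

/-- Linearity of `∂_A` over constant-coefficient sums. -/
lemma pd_sum_const_mul (hU : IsOpen U) {F : Fin m → (Fin m → ℝ) → ℝ}
    (hF : ∀ B, ContDiffOn ℝ (⊤ : ℕ∞) (F B) U) (a : Fin m → ℝ) (A : Fin m) :
    Set.EqOn (pd A (fun y => ∑ B, a B * F B y)) (fun y => ∑ B, a B * pd A (F B) y) U := by
  intro x hx
  have h : ∀ B, DifferentiableAt ℝ (F B) x := fun B =>
    (hF B).differentiableAt_of_isOpen hU hx
  rw [pd_sum _ fun B _ => (h B).const_mul (a B)]
  exact Finset.sum_congr rfl fun B _ => pd_const_mul (h B) _ _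

lemma pd_lap (hU : IsOpen U) (hf : ContDiffOn ℝ (⊤ : ℕ∞) f U) (ε : Fin m → ℝ) (A : Fin m) :
    Set.EqOn (lap ε (pd A f)) (pd A (lap ε f)) U := by
  intro x hx
  refine Eq.trans ?_ (pd_sum_const_mul hU (fun B => (hf.pd hU B).pd hU B) ε A hx).symm
  refine Finset.sum_congr rfl fun B _ => ?_
  rw [pd_eqOn hU (pd_comm hU hf B A) B hx, pd_comm hU (hf.pd hU B) B A hx]

lemma lap_dirDeriv (hU : IsOpen U) (hf : ContDiffOn ℝ (⊤ : ℕ∞) f U) (ε I : Fin m → ℝ) :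
    Set.EqOn (lap ε (dirDeriv I f)) (dirDeriv I (lap ε f)) U := by
  intro x hx
  have h : ∀ A, pd A (pd A (dirDeriv I f)) x = ∑ B, I B * pd A (pd A (pd B f)) x := fun A =>
    (pd_eqOn hU (pd_sum_const_mul hU (fun B => hf.pd hU B) I A) A hx).trans
      (pd_sum_const_mul hU (fun B => (hf.pd hU B).pd hU A) I A hx)
  simp only [lap, h, dirDeriv, Finset.mul_sum]
  rw [Finset.sum_comm]
  refine Finset.sum_congr rfl fun B _ => ?_
  have hB := pd_lap hU hf ε B hx
  simp only [lap] at hB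
  rw [← hB, Finset.mul_sum]
  exact Finset.sum_congr rfl fun A _ => by ring

lemma lap_linForm_mul (hU : IsOpen U) {ε : Fin m → ℝ} (hε : ∀ A, ε A * ε A = 1)
    (hf : ContDiffOn ℝ (⊤ : ℕ∞) f U) (I : Fin m → ℝ) :
    Set.EqOn (lap ε (fun y => linForm ε I y * f y))
      (fun y => linForm ε I y * lap ε f y + 2 * dirDeriv I f y) U := by
  intro x hx
  have hs : ∀ y, DifferentiableAt ℝ (linForm ε I) y := fun y =>
    (contDiff_linForm ε I).contDiffAt.differentiableAt (by simp)
  have h1 : ∀ A, Set.EqOn (pd A (fun y => linForm ε I y * f y))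
      (fun y => ε A * I A * f y + linForm ε I y * pd A f y) U := fun A y hy => by
    rw [pd_mul (hs y) (hf.differentiableAt_of_isOpen hU hy), pd_linForm]
  have h2 : ∀ A, pd A (pd A (fun y => linForm ε I y * f y)) x
      = 2 * (ε A * I A * pd A f x) + linForm ε I x * pd A (pd A f) x := fun A => by
    have hfx := hf.differentiableAt_of_isOpen hU hx
    have hpx := (hf.pd hU A).differentiableAt_of_isOpen hU hx
    rw [pd_eqOn hU (h1 A) A hx, pd_add (hfx.const_mul _) ((hs x).fun_mul hpx), pd_const_mul hfx, pd_mul (hs x) hpx, pd_linForm]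
    ring
  simp only [lap, h2, dirDeriv, Finset.mul_sum]
  rw [← Finset.sum_add_distrib]
  refine Finset.sum_congr rfl fun A _ => ?_
  linear_combination 2 * I A * pd A f x * hε A

lemma lap_const_mul_sub (hU : IsOpen U) (hf : ContDiffOn ℝ (⊤ : ℕ∞) f U)
    (hg : ContDiffOn ℝ (⊤ : ℕ∞) g U) (ε : Fin m → ℝ) (a : ℝ) :
    Set.EqOn (lap ε (fun y => a * f y - g y)) (fun y => a * lap ε f y - lap ε g y) U := by
  have h : ∀ (A : Fin m) {f g : (Fin m → ℝ) → ℝ}, ContDiffOn ℝ (⊤ : ℕ∞) f U →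
      ContDiffOn ℝ (⊤ : ℕ∞) g U →
      Set.EqOn (pd A (fun y => a * f y - g y)) (fun y => a * pd A f y - pd A g y) U := by
    intro A f g hf hg y hy
    have hfy := hf.differentiableAt_of_isOpen hU hy
    rw [pd_sub (hfy.const_mul a) (hg.differentiableAt_of_isOpen hU hy), pd_const_mul hfy]
  intro x hx
  simp only [lap, Finset.mul_sum]
  rw [← Finset.sum_sub_distrib]
  refine Finset.sum_congr rfl fun A _ => ?_
  rw [pd_eqOn hU (h A hf hg) A hx, h A (hf.pd hU A) (hg.pd hU A) hx]
  ring

/-- `□^k (a I·∂ - (I·X) □) = (a - 2k) (I·∂) □^k - (I·X) □^(k+1)`. -/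
lemma lap_iterate_dirDeriv_sub (hU : IsOpen U) {ε : Fin m → ℝ} (hε : ∀ A, ε A * ε A = 1)
    (hf : ContDiffOn ℝ (⊤ : ℕ∞) f U) (I : Fin m → ℝ) (a : ℝ) (k : ℕ) :
    Set.EqOn ((lap ε)^[k] (fun y => a * dirDeriv I f y - linForm ε I y * lap ε f y))
      (fun y => (a - 2 * k) * dirDeriv I ((lap ε)^[k] f) y
        - linForm ε I y * (lap ε)^[k + 1] f y) U := by
  induction k generalizing f a with
  | zero => intro x _; simp
  | succ k ih =>
    intro x hx
    have hl := hf.lap hU ε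
    have step : Set.EqOn (lap ε (fun y => a * dirDeriv I f y - linForm ε I y * lap ε f y))
        (fun y => (a - 2) * dirDeriv I (lap ε f) y - linForm ε I y * lap ε (lap ε f) y) U := by
      intro y hy
      rw [lap_const_mul_sub hU (hf.dirDeriv hU I) ((contDiff_linForm ε I).contDiffOn.mul hl) ε a hy]
      simp only [lap_dirDeriv hU hf ε I hy, lap_linForm_mul hU hε hl I hy]
      ring
    rw [Function.iterate_succ_apply, lap_iterate_eqOn hU ε step k hx, ih hl (a - 2) hx]
    simp only [Function.iterate_succ_apply]
    push_cast
    ring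

lemma euler_pd (hU : IsOpen U) (hf : ContDiffOn ℝ (⊤ : ℕ∞) f U) {w : ℝ}
    (hom : Set.EqOn (euler f) (fun y => w * f y) U) (A : Fin m) :
    Set.EqOn (euler (pd A f)) (fun y => (w - 1) * pd A f y) U := by
  intro x hx
  have h := pd_eqOn hU hom A hx
  rw [pd_const_mul (hf.differentiableAt_of_isOpen hU hx)] at h
  have hp : ∀ B, DifferentiableAt ℝ (pd B f) x := fun B =>
    (hf.pd hU B).differentiableAt_of_isOpen hU hx
  have h' : pd A (euler f) x = pd A f x + euler (pd A f) x := by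
    unfold euler
    rw [pd_sum _ fun B _ => (differentiableAt_apply B x).fun_mul (hp B)]
    simp_rw [pd_mul (differentiableAt_apply _ x) (hp _), pd_coord, Finset.sum_add_distrib,
      pd_comm hU hf A _ hx]
    simp
  simp only
  linarith

lemma euler_sum_const_mul (hU : IsOpen U) {F : Fin m → (Fin m → ℝ) → ℝ}
    (hF : ∀ B, ContDiffOn ℝ (⊤ : ℕ∞) (F B) U) {w : ℝ}
    (hom : ∀ B, Set.EqOn (euler (F B)) (fun y => w * F B y) U) (a : Fin m → ℝ) :
    Set.EqOn (euler (fun y => ∑ B, a B * F B y)) (fun y => w * ∑ B, a B * F B y) U := by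
  intro x hx
  simp only [euler, pd_sum_const_mul hU hF a _ hx, Finset.mul_sum]
  rw [Finset.sum_comm]
  refine Finset.sum_congr rfl fun B _ => ?_
  have h := hom B hx
  simp only [euler] at h
  rw [mul_left_comm w, ← h, Finset.mul_sum]
  exact Finset.sum_congr rfl fun A _ => by ring

lemma euler_lap (hU : IsOpen U) (hf : ContDiffOn ℝ (⊤ : ℕ∞) f U) {w : ℝ}
    (hom : Set.EqOn (euler f) (fun y => w * f y) U) (ε : Fin m → ℝ) :
    Set.EqOn (euler (lap ε f)) (fun y => (w - 1 - 1) * lap ε f y) U :=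
  euler_sum_const_mul hU (fun A => (hf.pd hU A).pd hU A)
    (fun A => euler_pd hU (hf.pd hU A) (euler_pd hU hf hom A) A) ε

lemma euler_linForm_mul (hU : IsOpen U) (hf : ContDiffOn ℝ (⊤ : ℕ∞) f U) {w : ℝ}
    (hom : Set.EqOn (euler f) (fun y => w * f y) U) (ε I : Fin m → ℝ) :
    Set.EqOn (euler (fun y => linForm ε I y * f y))
      (fun y => (w + 1) * (linForm ε I y * f y)) U := by
  intro x hx
  have hs : DifferentiableAt ℝ (linForm ε I) x :=
    (contDiff_linForm ε I).contDiffAt.differentiableAt (by simp)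
  have h := hom hx
  simp only [euler] at h
  simp only [euler, pd_mul hs (hf.differentiableAt_of_isOpen hU hx), pd_linForm]
  have e : (w + 1) * (linForm ε I x * f x)
      = linForm ε I x * f x + linForm ε I x * (w * f x) := by ring
  rw [e, ← h, linForm, Finset.sum_mul, Finset.mul_sum, ← Finset.sum_add_distrib]
  exact Finset.sum_congr rfl fun A _ => by ring

lemma euler_const_mul_sub (hU : IsOpen U) (hf : ContDiffOn ℝ (⊤ : ℕ∞) f U)
    (hg : ContDiffOn ℝ (⊤ : ℕ∞) g U) {w : ℝ} (hof : Set.EqOn (euler f) (fun y => w * f y) U)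
    (hog : Set.EqOn (euler g) (fun y => w * g y) U) (a : ℝ) :
    Set.EqOn (euler (fun y => a * f y - g y)) (fun y => w * (a * f y - g y)) U := by
  intro x hx
  have hfx := hf.differentiableAt_of_isOpen hU hx
  have h1 := hof hx
  have h2 := hog hx
  have h : euler (fun y => a * f y - g y) x = a * euler f x - euler g x := by
    simp only [euler, pd_sub (hfx.const_mul a) (hg.differentiableAt_of_isOpen hU hx),
      pd_const_mul hfx, Finset.mul_sum]
    rw [← Finset.sum_sub_distrib]
    exact Finset.sum_congr rfl fun A _ => by ring
  simp only at h1 h2 ⊢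
  rw [h, h1, h2]
  ring

/-- On homogeneous functions of degree `w`, `I·D = 2(w - 1 + c) I·∂ - (I·X) □`. -/
lemma opID_eqOn (hU : IsOpen U) (hf : ContDiffOn ℝ (⊤ : ℕ∞) f U) {w : ℝ}
    (hom : Set.EqOn (euler f) (fun y => w * f y) U) (ε : Fin m → ℝ) (c : ℝ) (I : Fin m → ℝ) :
    Set.EqOn (opID ε c I f)
      (fun y => 2 * (w - 1 + c) * dirDeriv I f y - linForm ε I y * lap ε f y) U := by
  intro x hx
  simp only [opID, thomasD, euler_pd hU hf hom _ hx, dirDeriv, linForm]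
  rw [Finset.mul_sum, Finset.sum_mul, ← Finset.sum_sub_distrib]
  exact Finset.sum_congr rfl fun A _ => by ring

/-- The identity `(I·D)^ℓ = (-1)^ℓ (I·X)^ℓ □^ℓ` in degree `ℓ - c`, on any open set. -/
lemma opID_iterate_eqOn (hU : IsOpen U) {ε : Fin m → ℝ} (hε : ∀ A, ε A * ε A = 1)
    (c : ℝ) (I : Fin m → ℝ) (ℓ : ℕ) (hf : ContDiffOn ℝ (⊤ : ℕ∞) f U)
    (hom : Set.EqOn (euler f) (fun y => ((ℓ : ℝ) - c) * f y) U) :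
    Set.EqOn ((opID ε c I)^[ℓ] f)
      (fun y => (-1 : ℝ) ^ ℓ * linForm ε I y ^ ℓ * (lap ε)^[ℓ] f y) U := by
  induction ℓ generalizing f with
  | zero => intro x _; simp
  | succ k ih =>
    have hl := hf.lap hU ε
    have hd := hf.dirDeriv hU I
    have hsl := (contDiff_linForm ε I).contDiffOn (s := U).mul hl
    have hop : Set.EqOn (opID ε c I f)
        (fun y => (2 * k) * dirDeriv I f y - linForm ε I y * lap ε f y) U := by
      intro y hy
      rw [opID_eqOn hU hf hom ε c I hy]
      push_cast
      ring
    have hdeg : Set.EqOn (euler (fun y => (2 * k) * dirDeriv I f y - linForm ε I y * lap ε f y))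
        (fun y => ((k : ℝ) - c) *
          ((2 * k) * dirDeriv I f y - linForm ε I y * lap ε f y)) U := by
      refine euler_const_mul_sub hU hd hsl ?_ ?_ _
      · intro y hy
        refine (euler_sum_const_mul hU (fun A => hf.pd hU A)
          (fun A => euler_pd hU hf hom A) I hy).trans ?_
        simp only [dirDeriv]
        push_cast
        ring
      · intro y hy
        refine (euler_linForm_mul hU hl (euler_lap hU hf hom ε) ε I hy).trans ?_
        push_cast
        ring
    have hsm : ContDiffOn ℝ (⊤ : ℕ∞) (opID ε c I f) U :=
      ((contDiffOn_const.mul hd).sub hsl).congr hop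
    intro x hx
    rw [Function.iterate_succ_apply, ih hsm ?_ hx]
    · simp only [lap_iterate_eqOn hU ε hop k hx,
        lap_iterate_dirDeriv_sub hU hε hf I (2 * k) k hx]
      ring
    · intro y hy
      simp only [euler_eqOn hU hop hy, hdeg hy, hop hy]

end Calculus

/-- for a fixed vector `I` and `Φ` smooth on `ℝ^{n+2} ∖ {0}` homogeneous of
degree `ℓ - n/2`, `(I·D)^ℓ Φ = (-1)^ℓ (I·X)^ℓ □^ℓ Φ`. -/
theorem opID_pow_eq_lap_pow
    (n : ℕ) (hn : 1 ≤ n) (ε : Fin (n + 2) → ℝ) (hsig : isSig ε 2)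
    (ℓ : ℕ) (hℓ : 1 ≤ ℓ) (I : Fin (n + 2) → ℝ) (Φ : (Fin (n + 2) → ℝ) → ℝ)
    (hΦ : ContDiffOn ℝ (⊤ : ℕ∞) Φ {x | x ≠ 0})
    (hom : ∀ x : Fin (n + 2) → ℝ, x ≠ 0 →
      euler Φ x = ((ℓ : ℝ) - (n : ℝ) / 2) * Φ x) :
    ∀ x : Fin (n + 2) → ℝ, x ≠ 0 →
      (opID ε ((n : ℝ) / 2) I)^[ℓ] Φ x
        = (-1 : ℝ) ^ ℓ * (∑ A, ε A * I A * x A) ^ ℓ * (lap ε)^[ℓ] Φ x := by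
  have hε : ∀ A, ε A * ε A = 1 := fun A => by
    rcases hsig.1 A with h | h <;> simp [h]
  exact fun x hx => opID_iterate_eqOn isOpen_ne hε _ I ℓ hΦ hom hx

end
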